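/- Let Φ : ℝ^{2n} × ℝ^{2n} → ℝ^{4n} be the change of variables Φ(l,r) = ((1/2)(l+r), J(l-r)), the inverse of z ↦ (l(z), r(z)) where l(x,y) = x - (1/2)Jy and r(x,y) = x + (1/2)Jy. Then for all continuously differentiable F, G : ℝ^{4n} → ℝ, the secondary Poisson bracket decomposes as {F,G}_2(Φ(l,r)) = ∇_l(F∘Φ)·J∇_l(G∘Φ) - ∇_r(F∘Φ)·J∇_r(G∘Φ), where ∇_l and ∇_r denote the gradients of F∘Φ and G∘Φ in the first and second ℝ^{2n} arguments evaluated at (l,r). -/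

import Mathlib

open Matrix MeasureTheory

noncomputable section

abbrev Vec (n : ℕ) := Fin (2*n) → ℝ

/-- The `2n×2n` symplectic matrix `J = [[0, Iₙ], [-Iₙ, 0]]`. -/
def symJ (n : ℕ) : Matrix (Fin (2*n)) (Fin (2*n)) ℝ :=
  Matrix.of fun i j =>
    if i.val < n ∧ j.val = i.val + n then 1
    else if j.val < n ∧ i.val = j.val + n then -1 else 0

/-- Gradient of a scalar function on `ℝ^m`, as the vector of partial derivatives. -/
def grad {m : ℕ} (f : (Fin m → ℝ) → ℝ) (x : Fin m → ℝ) : Fin m → ℝ :=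
  fun i => fderiv ℝ f x (Pi.single i 1)

/-- Primary Poisson bracket `{f,g}₁(x) = ∇f(x) · J ∇g(x)`. -/
def pb1 (n : ℕ) (f g : Vec n → ℝ) (x : Vec n) : ℝ :=
  grad f x ⬝ᵥ (symJ n).mulVec (grad g x)

/-- `x`-gradient of a function on secondary phase space `ℝ^{2n} × ℝ^{2n}`. -/
def grad2x (n : ℕ) (F : Vec n × Vec n → ℝ) (z : Vec n × Vec n) : Vec n :=
  fun i => fderiv ℝ F z (Pi.single i 1, 0)

/-- `y`-gradient of a function on secondary phase space `ℝ^{2n} × ℝ^{2n}`. -/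
def grad2y (n : ℕ) (F : Vec n × Vec n → ℝ) (z : Vec n × Vec n) : Vec n :=
  fun i => fderiv ℝ F z (0, Pi.single i 1)

/-- Secondary Poisson bracket `{F,G}₂(z) = ∇F(z) · J̃ ∇G(z)` with
`J̃ = [[0, I_{2n}], [-I_{2n}, 0]]`, i.e. `∇ₓF·∇_yG - ∇_yF·∇ₓG`. -/
def pb2 (n : ℕ) (F G : Vec n × Vec n → ℝ) (z : Vec n × Vec n) : ℝ :=
  grad2x n F z ⬝ᵥ grad2y n G z - grad2y n F z ⬝ᵥ grad2x n G z

/-- Left projection `l(x,y) = x - (1/2) J y`. -/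
def lmap (n : ℕ) (z : Vec n × Vec n) : Vec n := z.1 - (1/2 : ℝ) • (symJ n).mulVec z.2

/-- Right projection `r(x,y) = x + (1/2) J y`. -/
def rmap (n : ℕ) (z : Vec n × Vec n) : Vec n := z.1 + (1/2 : ℝ) • (symJ n).mulVec z.2

/-- Hessian matrix of a scalar function on `ℝ^m`. -/
def hess {m : ℕ} (f : (Fin m → ℝ) → ℝ) (x : Fin m → ℝ) : Matrix (Fin m) (Fin m) ℝ :=
  Matrix.of fun i j => fderiv ℝ (fun y => fderiv ℝ f y (Pi.single j 1)) x (Pi.single i 1)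

/-- Jacobian matrix of a map `ℝ^m → ℝ^m`. -/
def jac {m : ℕ} (f : (Fin m → ℝ) → (Fin m → ℝ)) (x : Fin m → ℝ) :
    Matrix (Fin m) (Fin m) ℝ :=
  Matrix.of fun i j => fderiv ℝ f x (Pi.single j 1) i

/-- Operator norm of a matrix acting on Euclidean space `ℝ^m`. -/
def opNorm {m : ℕ} (A : Matrix (Fin m) (Fin m) ℝ) : ℝ :=
  ‖Matrix.toEuclideanCLM (𝕜 := ℝ) A‖

/-- Symplectic pairing `x ∧ y = x · J y`. -/
def wedgeP (n : ℕ) (x y : Vec n) : ℝ := x ⬝ᵥ (symJ n).mulVec y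

/-- The change of variables `Φ(l,r) = ((1/2)(l+r), J(l-r))`. -/
def lrPhi (n : ℕ) (lr : Vec n × Vec n) : Vec n × Vec n :=
  ((1/2 : ℝ) • (lr.1 + lr.2), (symJ n).mulVec (lr.1 - lr.2))

theorem symJ_transpose (n : ℕ) : (symJ n)ᵀ = -symJ n := by
  ext i j
  simp only [symJ, Matrix.transpose_apply, Matrix.of_apply, Matrix.neg_apply]
  split_ifs <;> first | omega | norm_num

theorem symJ_mulVec_lt (n : ℕ) (v : Vec n) (i : Fin (2*n)) (hi : i.val < n) :
    (symJ n).mulVec v i = v ⟨i.val + n, by omega⟩ := by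
  rw [Matrix.mulVec, dotProduct, Finset.sum_eq_single (⟨i.val + n, by omega⟩ : Fin (2*n))]
  · simp [symJ, hi]
  · intro j _ hj
    have hj' : j.val ≠ i.val + n := fun h => hj (Fin.ext h)
    have h2 : ¬ (j.val < n ∧ i.val = j.val + n) := by omega
    simp [symJ, hj', h2]
  · simp

theorem symJ_mulVec_ge (n : ℕ) (v : Vec n) (i : Fin (2*n)) (hi : n ≤ i.val) :
    (symJ n).mulVec v i = - v ⟨i.val - n, by omega⟩ := by
  have hi2 := i.isLt
  rw [Matrix.mulVec, dotProduct, Finset.sum_eq_single (⟨i.val - n, by omega⟩ : Fin (2*n))]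
  · have h1 : ¬ (i.val < n) := by omega
    have h2 : i.val - n < n := by omega
    simp [symJ, h1, h2, hi]
  · intro j _ hj
    have hj' : j.val ≠ i.val - n := fun h => hj (Fin.ext h)
    have h1 : ¬ (i.val < n) := by omega
    have h2 : ¬ (j.val < n ∧ i.val = j.val + n) := by omega
    simp [symJ, h1, h2]
  · simp

theorem symJ_symJ (n : ℕ) (v : Vec n) :
    (symJ n).mulVec ((symJ n).mulVec v) = -v := by
  ext i
  have hi2 := i.isLt
  by_cases hi : i.val < n
  · rw [symJ_mulVec_lt n _ i hi, symJ_mulVec_ge n _ _ (by simp)]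
    simp
  · have hi' : n ≤ i.val := by omega
    rw [symJ_mulVec_ge n _ i hi', symJ_mulVec_lt n _ _ (by simp; omega)]
    simp [hi']

theorem symJ_dot (n : ℕ) (v w : Vec n) :
    (symJ n).mulVec v ⬝ᵥ w = - (v ⬝ᵥ (symJ n).mulVec w) := by
  rw [Matrix.dotProduct_mulVec, ← Matrix.mulVec_transpose, symJ_transpose, Matrix.neg_mulVec,
    neg_dotProduct, neg_neg]

/-- `Φ` as a continuous linear map. -/
def lrPhiL (n : ℕ) : (Vec n × Vec n) →L[ℝ] (Vec n × Vec n) :=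
  LinearMap.toContinuousLinearMap
    { toFun := lrPhi n
      map_add' := by
        intro a b
        simp only [lrPhi, Prod.fst_add, Prod.snd_add, Prod.mk_add_mk, ← Matrix.mulVec_add,
          ← smul_add]
        congr 2 <;> abel
      map_smul' := by
        intro c a
        simp only [lrPhi, Prod.smul_fst, Prod.smul_snd, Prod.smul_mk, ← Matrix.mulVec_smul,
          RingHom.id_apply, ← smul_add, ← smul_sub, smul_comm c] }

theorem fderiv_comp_lrPhi (n : ℕ) (F : Vec n × Vec n → ℝ) (hF : ContDiff ℝ 1 F)
    (p v : Vec n × Vec n) :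
    fderiv ℝ (F ∘ lrPhi n) p v = fderiv ℝ F (lrPhi n p) (lrPhi n v) := by
  have h1 : HasFDerivAt (lrPhi n) (lrPhiL n) p := (lrPhiL n).hasFDerivAt
  have h2 := ((hF.differentiable one_ne_zero) (lrPhi n p)).hasFDerivAt
  rw [(h2.comp p h1).fderiv]
  rfl

theorem lin_eq_dot (n : ℕ) (F : Vec n × Vec n → ℝ) (z v : Vec n × Vec n) :
    fderiv ℝ F z v = grad2x n F z ⬝ᵥ v.1 + grad2y n F z ⬝ᵥ v.2 := by
  set L := fderiv ℝ F z with hL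
  have e : v = (v.1, 0) + (0, v.2) := by simp
  have a1 := LinearMap.pi_apply_eq_sum_univ
    (L.toLinearMap ∘ₗ LinearMap.inl ℝ (Vec n) (Vec n)) v.1
  have a2 := LinearMap.pi_apply_eq_sum_univ
    (L.toLinearMap ∘ₗ LinearMap.inr ℝ (Vec n) (Vec n)) v.2
  have s : ∀ i : Fin (2*n), (fun j => if i = j then (1:ℝ) else 0) = Pi.single i 1 := by
    intro i; ext j; simp [Pi.single_apply, eq_comm]
  simp only [s] at a1 a2
  simp only [LinearMap.comp_apply, LinearMap.inl_apply, LinearMap.inr_apply,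
    ContinuousLinearMap.coe_coe, smul_eq_mul] at a1 a2
  rw [e, map_add, a1, a2]
  simp only [grad2x, grad2y, dotProduct, ← hL, Prod.fst_add, Prod.snd_add, add_zero, zero_add,
    mul_comm]

theorem grad2x_comp (n : ℕ) (F : Vec n × Vec n → ℝ) (hF : ContDiff ℝ 1 F) (p : Vec n × Vec n) :
    grad2x n (F ∘ lrPhi n) p = (1/2 : ℝ) • grad2x n F (lrPhi n p)
      - (symJ n).mulVec (grad2y n F (lrPhi n p)) := by
  ext i
  have h := symJ_dot n (grad2y n F (lrPhi n p)) (Pi.single i 1)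
  rw [dotProduct_single_one] at h
  rw [grad2x, fderiv_comp_lrPhi n F hF, lin_eq_dot]
  simp only [lrPhi, add_zero, sub_zero, dotProduct_smul, dotProduct_single_one] at h ⊢
  simp only [Pi.sub_apply, Pi.smul_apply, h]
  ring

theorem grad2y_comp (n : ℕ) (F : Vec n × Vec n → ℝ) (hF : ContDiff ℝ 1 F) (p : Vec n × Vec n) :
    grad2y n (F ∘ lrPhi n) p = (1/2 : ℝ) • grad2x n F (lrPhi n p)
      + (symJ n).mulVec (grad2y n F (lrPhi n p)) := by
  ext i
  have h := symJ_dot n (grad2y n F (lrPhi n p)) (Pi.single i 1)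
  rw [dotProduct_single_one] at h
  rw [grad2y, fderiv_comp_lrPhi n F hF, lin_eq_dot]
  simp only [lrPhi, zero_add, zero_sub, Matrix.mulVec_neg, dotProduct_neg, dotProduct_smul,
    dotProduct_single_one] at h ⊢
  simp only [Pi.add_apply, Pi.smul_apply, h]

/-- `Φ` inverts `z ↦ (l(z), r(z))`, and in the `(l,r)` variables the secondary
Poisson bracket decomposes as
`{F,G}₂(Φ(l,r)) = ∇_l(F∘Φ)·J∇_l(G∘Φ) - ∇_r(F∘Φ)·J∇_r(G∘Φ)`. -/
theorem stmt2 (n : ℕ) (F G : Vec n × Vec n → ℝ)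
    (hF : ContDiff ℝ 1 F) (hG : ContDiff ℝ 1 G) :
    (∀ z : Vec n × Vec n, lrPhi n (lmap n z, rmap n z) = z) ∧
    ∀ l r : Vec n,
      pb2 n F G (lrPhi n (l, r)) =
        grad2x n (F ∘ lrPhi n) (l, r) ⬝ᵥ (symJ n).mulVec (grad2x n (G ∘ lrPhi n) (l, r))
        - grad2y n (F ∘ lrPhi n) (l, r) ⬝ᵥ (symJ n).mulVec (grad2y n (G ∘ lrPhi n) (l, r)) := by
  constructor
  · intro z
    have h1 : lmap n z + rmap n z = (2:ℝ) • z.1 := by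
      simp only [lmap, rmap, two_smul]; abel
    have h2 : lmap n z - rmap n z = - (symJ n).mulVec z.2 := by
      ext i
      simp only [lmap, rmap, Pi.sub_apply, Pi.add_apply, Pi.smul_apply, Pi.neg_apply, smul_eq_mul]
      ring
    simp only [lrPhi, h1, h2, Matrix.mulVec_neg, symJ_symJ, neg_neg, smul_smul]
    norm_num
  · intro l r
    rw [grad2x_comp n F hF, grad2x_comp n G hG, grad2y_comp n F hF, grad2y_comp n G hG, pb2]
    simp only [Matrix.mulVec_sub, Matrix.mulVec_add, Matrix.mulVec_smul, symJ_symJ,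
      sub_dotProduct, add_dotProduct, dotProduct_sub, dotProduct_add, smul_dotProduct,
      dotProduct_smul, dotProduct_neg, symJ_dot, smul_eq_mul]
    ring
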